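/- arXiv:1812.04634 — 6 statements merged into one kernel-verified Lean document; each statement's English description precedes it below -/
import Mathlib

section
/- Let 0 < μ ≤ L, let H be a real symmetric positive definite n×n matrix all of whose eigenvalues lie in [μ, L], and set η = √(μL). Define the 2n×2n real matrix A in block form as A = [[−I, −(1/η)I + H⁻¹], [ηI, −ηH⁻¹]]. Then every complex eigenvalue of A has real part at most −√μ/(√μ + √L). -/
/-- If `0 < p ≤ q` and `0 < t ≤ q / p`, every complex root of `z² + (1 + t) z + 1` has real part
at most `-p / (p + q)`. -/
theorem re_le_of_quadratic {p q t : ℝ} (hp : 0 < p) (hpq : p ≤ q) (ht : 0 < t)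
    (htq : t * p ≤ q) {z : ℂ} (hz : z ^ 2 + (1 + t) * z + 1 = 0) :
    z.re ≤ -(p / (p + q)) := by
  have hs : 0 < p + q := by linarith
  have hre := congrArg Complex.re hz
  have him := congrArg Complex.im hz
  simp [pow_two] at hre him
  rw [← neg_div, le_div_iff₀ hs]
  have him' : z.im * (2 * z.re + (1 + t)) = 0 := by linarith
  rcases mul_eq_zero.mp him' with h | h
  · rw [h] at hre
    have hneg : z.re < 0 := by
      by_contra! h0
      nlinarith [mul_nonneg ht.le h0, mul_nonneg h0 h0]
    by_contra! hlt
    nlinarith [mul_pos_of_neg_of_neg hneg hneg,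
      mul_nonneg (neg_nonneg.mpr hneg.le) (sub_nonneg.mpr htq),
      mul_pos hp (mul_pos_of_neg_of_neg hneg hneg)]
  · nlinarith

/-- The roots of the characteristic polynomial of a complex matrix are its eigenvalues. -/
theorem isRoot_charpoly_iff_exists_mulVec_eq_smul {m : Type*} [Fintype m] [DecidableEq m]
    {A : Matrix m m ℂ} {z : ℂ} :
    A.charpoly.IsRoot z ↔ ∃ v, v ≠ 0 ∧ A.mulVec v = z • v := by
  rw [Polynomial.IsRoot.def, Matrix.eval_charpoly, ← Matrix.exists_mulVec_eq_zero_iff]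
  simp [Matrix.sub_mulVec, Matrix.scalar_apply, ← Matrix.smul_one_eq_diagonal,
    Matrix.smul_mulVec, sub_eq_zero, eq_comm]

/-- A complex eigenvalue of a real symmetric matrix is one of its real eigenvalues. -/
theorem exists_eigenvalues_eq_of_mulVec_map_eq_smul {m : Type*} [Fintype m] [DecidableEq m]
    {H : Matrix m m ℝ} (hH : H.IsHermitian) {w : ℂ} {v : m → ℂ} (hv : v ≠ 0)
    (h : (H.map Complex.ofRealHom).mulVec v = w • v) :
    ∃ i, (hH.eigenvalues i : ℂ) = w := by
  have hroot := isRoot_charpoly_iff_exists_mulVec_eq_smul.mpr ⟨v, hv, h⟩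
  rw [Polynomial.IsRoot.def, Matrix.charpoly_map, hH.charpoly_eq, Polynomial.map_prod,
    Polynomial.eval_prod, Finset.prod_eq_zero_iff] at hroot
  obtain ⟨i, -, hi⟩ := hroot
  exact ⟨i, (sub_eq_zero.mp (by simpa using hi)).symm⟩

/-- For `0 < μ ≤ L`, `H` real symmetric positive definite with all eigenvalues
in `[μ, L]`, and `η = √(μL)`, every complex eigenvalue (root of the characteristic
polynomial over ℂ) of the block matrix
`A = [[−I, −(1/η)I + H⁻¹], [ηI, −ηH⁻¹]]` has real part at most `−√μ/(√μ + √L)`. -/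
theorem prox_ode_matrix_eigenvalue_bound {n : ℕ} (μ L η : ℝ)
    (hμ : 0 < μ) (hμL : μ ≤ L) (hη : η = Real.sqrt (μ * L))
    (H : Matrix (Fin n) (Fin n) ℝ) (hH : H.PosDef)
    (heig : ∀ i, hH.isHermitian.eigenvalues i ∈ Set.Icc μ L) :
    ∀ z : ℂ,
      ((Matrix.fromBlocks (-1 : Matrix (Fin n) (Fin n) ℝ) ((-(1/η)) • 1 + H⁻¹)
          (η • (1 : Matrix (Fin n) (Fin n) ℝ)) ((-η) • H⁻¹)).map
        (fun a => (a : ℂ))).charpoly.IsRoot z →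
      z.re ≤ -(Real.sqrt μ / (Real.sqrt μ + Real.sqrt L)) := by
  intro z hz
  have hL : 0 < L := hμ.trans_le hμL
  have hη0 : 0 < η := hη ▸ Real.sqrt_pos.mpr (mul_pos hμ hL)
  have hηC : (η : ℂ) ≠ 0 := by exact_mod_cast hη0.ne'
  obtain ⟨x, hx, hAx⟩ := isRoot_charpoly_iff_exists_mulVec_eq_smul.mp hz
  obtain ⟨u, v, rfl⟩ : ∃ u v, x = Sum.elim u v := ⟨_, _, (Sum.elim_comp_inl_inr x).symm⟩
  set K := H⁻¹.map Complex.ofRealHom with hK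
  have hblocks : (Matrix.fromBlocks (-1 : Matrix (Fin n) (Fin n) ℝ) ((-(1/η)) • 1 + H⁻¹)
      (η • (1 : Matrix (Fin n) (Fin n) ℝ)) ((-η) • H⁻¹)).map (fun a => (a : ℂ)) =
      Matrix.fromBlocks (-1) ((-(1/η : ℂ)) • 1 + K) ((η : ℂ) • 1) ((-η : ℂ) • K) := by
    rw [Matrix.fromBlocks_map]
    congr 1 <;> ext i j <;> by_cases hij : i = j <;> simp [hK, hij]
  rw [hblocks, Matrix.fromBlocks_mulVec] at hAx
  have htop : ∀ i, -u i + (-(1/η : ℂ) * v i + K.mulVec v i) = z * u i := fun i => by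
    simpa [Matrix.add_mulVec, Matrix.smul_mulVec, Matrix.neg_mulVec] using
      congrFun hAx (Sum.inl i)
  have hbot : ∀ i, η * u i + -η * K.mulVec v i = z * v i := fun i => by
    simpa [Matrix.add_mulVec, Matrix.smul_mulVec, Matrix.neg_mulVec] using
      congrFun hAx (Sum.inr i)
  have hsum : ∀ i, z * η * u i = -(1 + z) * v i := fun i => by
    have h := htop i
    field_simp at h
    linear_combination -h - hbot i
  have hz0 : z ≠ 0 := by
    rintro rfl
    have hv : v = 0 := funext fun i => by simpa using hsum i
    have hu : u = 0 := funext fun i => by simpa [hv, hηC] using hbot i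
    exact hx (by simp [hu, hv])
  have hv : v ≠ 0 := by
    rintro rfl
    have hu : u = 0 := funext fun i => by simpa [hz0, hηC] using hsum i
    exact hx (by simp [hu])
  have hKv : (z * η) • K.mulVec v = (-(z ^ 2 + z + 1)) • v := funext fun i => by
    simp only [Pi.smul_apply, smul_eq_mul]
    linear_combination hsum i - z * hbot i
  have hHK : H.map Complex.ofRealHom * K = 1 := by
    rw [hK, ← Matrix.map_mul, Matrix.mul_nonsing_inv _ ((Matrix.isUnit_iff_isUnit_det H).mp hH.isUnit)]
    simp
  have hHv : (z * η) • v = (-(z ^ 2 + z + 1)) • (H.map Complex.ofRealHom).mulVec v := by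
    rw [← Matrix.mulVec_smul, ← hKv, Matrix.mulVec_smul, Matrix.mulVec_mulVec, hHK,
      Matrix.one_mulVec]
  have hc : -(z ^ 2 + z + 1) ≠ 0 := by
    intro h
    rw [h, zero_smul] at hHv
    exact (smul_ne_zero (mul_ne_zero hz0 hηC) hv) hHv
  obtain ⟨i, hi⟩ := exists_eigenvalues_eq_of_mulVec_map_eq_smul hH.isHermitian hv
    (w := z * η / -(z ^ 2 + z + 1)) (by
      rw [div_eq_inv_mul, mul_smul, hHv, inv_smul_smul₀ hc])
  obtain ⟨hlo, -⟩ := heig i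
  set l := hH.isHermitian.eigenvalues i
  have hl : 0 < l := hμ.trans_le hlo
  have hlC : (l : ℂ) ≠ 0 := by exact_mod_cast hl.ne'
  refine re_le_of_quadratic (Real.sqrt_pos.mpr hμ) (Real.sqrt_le_sqrt hμL) (div_pos hη0 hl) ?_
    (t := η / l) ?_
  · rw [div_mul_eq_mul_div, div_le_iff₀ hl, hη, Real.sqrt_mul hμ.le]
    nlinarith [Real.mul_self_sqrt hμ.le, Real.sqrt_nonneg L]
  · rw [eq_div_iff hc] at hi
    push_cast
    field_simp
    linear_combination -hi
end

section
/- Let 0 < μ ≤ L, let H be a real symmetric positive definite n×n matrix all of whose eigenvalues lie in [μ, L], set η = √(μL), τ = L/η, and let α ∈ [0, 1]. Define the 2n×2n real matrix A in block form as A = [[−(α/(ητ))H, −(1/η)I + (α/(ητ))I], [(1/τ)H, −(1/τ)I]]. Then every complex eigenvalue of A has real part at most −(1/2)√(μ/L). -/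
open scoped Matrix

theorem Complex.re_le_of_quadratic_root {s k α : ℝ} (hs : 0 < s) (hsk : s ^ 2 ≤ k) (hs1 : s ≤ 1)
    (hα0 : 0 ≤ α) (hα1 : α ≤ 1) {z : ℂ} (hz : z ^ 2 + (α * k + s) * z + k = 0) :
    z.re ≤ -(s / 2) := by
  have hre := congrArg Complex.re hz
  have him := congrArg Complex.im hz
  simp only [pow_two, Complex.add_re, Complex.mul_re, Complex.add_im, Complex.mul_im,
    Complex.ofReal_re, Complex.ofReal_im, Complex.zero_re, Complex.zero_im] at hre him
  have hk : 0 < k := lt_of_lt_of_le (by positivity) hsk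
  have hαk : 0 ≤ α * k := mul_nonneg hα0 hk.le
  have him' : z.im * (2 * z.re + α * k + s) = 0 := by linear_combination him
  rcases mul_eq_zero.mp him' with hv | hv
  · by_contra! hlt
    have hαs : α * s ≤ 1 := mul_le_one₀ hα1 hs.le hs1
    have hαsk : α * s * k ≤ k := mul_le_of_le_one_left hk.le hαs
    have hd : 0 < z.re + s / 2 := by linarith
    rw [hv] at hre
    nlinarith [mul_nonneg hd.le hαk, mul_pos hd hd, mul_pos hs hs]
  · linarith

theorem Matrix.IsHermitian.exists_isUnit_mul_map_ofReal_eq {ι : Type*} [Fintype ι] [DecidableEq ι]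
    {H : Matrix ι ι ℝ} (hH : H.IsHermitian) :
    ∃ P : Matrix ι ι ℂ, IsUnit P ∧
      P * H.map (fun a => (a : ℂ)) =
        Matrix.diagonal (fun i => (hH.eigenvalues i : ℂ)) * P := by
  let U : Matrix ι ι ℝ := hH.eigenvectorUnitary
  have hU : star U * U = 1 := Unitary.coe_star_mul_self hH.eigenvectorUnitary
  have hspec : star U * H = Matrix.diagonal hH.eigenvalues * star U := by
    have h : H = U * Matrix.diagonal hH.eigenvalues * star U := by
      simpa [Unitary.conjStarAlgAut_apply] using hH.spectral_theorem
    calc star U * H = star U * (U * Matrix.diagonal hH.eigenvalues * star U) := by rw [← h]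
      _ = star U * U * Matrix.diagonal hH.eigenvalues * star U := by simp only [mul_assoc]
      _ = _ := by rw [hU, one_mul]
  refine ⟨Complex.ofRealHom.mapMatrix (star U),
    (IsUnit.of_mul_eq_one U hU).map Complex.ofRealHom.mapMatrix, ?_⟩
  have h := congrArg Complex.ofRealHom.mapMatrix hspec
  rw [map_mul, map_mul] at h
  refine h.trans (congrArg (· * _) ?_)
  simp [Matrix.diagonal_map]

/-- A root of the characteristic polynomial of a block matrix whose blocks are real multiples of
`H` and of the identity is a root of the characteristic polynomial of the `2 × 2` matrix obtained
by replacing `H` with one of its eigenvalues. -/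
theorem Matrix.IsHermitian.exists_eigenvalue_of_isRoot_charpoly_fromBlocks {ι : Type*} [Fintype ι]
    [DecidableEq ι] {H : Matrix ι ι ℝ} (hH : H.IsHermitian) (a b c d : ℝ) {z : ℂ}
    (hz : ((Matrix.fromBlocks (a • H) (b • (1 : Matrix ι ι ℝ)) (c • H)
      (d • (1 : Matrix ι ι ℝ))).map (fun r => (r : ℂ))).charpoly.IsRoot z) :
    ∃ i, (z - a * hH.eigenvalues i) * (z - d) - b * (c * hH.eigenvalues i) = 0 := by
  obtain ⟨P, hP, hPH⟩ := hH.exists_isUnit_mul_map_ofReal_eq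
  rw [Polynomial.IsRoot, Matrix.eval_charpoly] at hz
  obtain ⟨v, hv0, hv⟩ := Matrix.exists_mulVec_eq_zero_iff.mpr hz
  obtain ⟨x, y, rfl⟩ : ∃ x y, v = Sum.elim x y := ⟨_, _, (Sum.elim_comp_inl_inr v).symm⟩
  set K : Matrix ι ι ℂ := H.map (fun r => (r : ℂ)) with hK
  have hsmul (r : ℝ) : (r • H).map (fun r => (r : ℂ)) = (r : ℂ) • K := by
    ext; simp [hK]
  have hone (r : ℝ) : (r • (1 : Matrix ι ι ℝ)).map (fun r => (r : ℂ)) = (r : ℂ) • 1 := by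
    ext i j; by_cases h : i = j <;> simp [h]
  rw [Matrix.fromBlocks_map, hsmul, hsmul, hone, hone, Matrix.sub_mulVec,
    Matrix.fromBlocks_mulVec, sub_eq_zero] at hv
  simp only [Matrix.scalar_apply, Matrix.smul_mulVec, Matrix.one_mulVec, Sum.elim_comp_inl,
    Sum.elim_comp_inr] at hv
  have hx : z • x = (a : ℂ) • K *ᵥ x + (b : ℂ) • y := by
    ext i; simpa [Matrix.mulVec_diagonal] using congrFun hv (Sum.inl i)
  have hy : z • y = (c : ℂ) • K *ᵥ x + (d : ℂ) • y := by
    ext i; simpa [Matrix.mulVec_diagonal] using congrFun hv (Sum.inr i)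
  have hPK (i : ι) : ((P * K) *ᵥ x) i = hH.eigenvalues i * (P *ᵥ x) i := by
    rw [hPH, ← Matrix.mulVec_mulVec, Matrix.mulVec_diagonal]
  have hpx (i : ι) : z * (P *ᵥ x) i =
      a * (hH.eigenvalues i * (P *ᵥ x) i) + b * (P *ᵥ y) i := by
    simpa [Matrix.mulVec_add, Matrix.mulVec_smul, hPK] using congrFun (congrArg (P *ᵥ ·) hx) i
  have hpy (i : ι) : z * (P *ᵥ y) i =
      c * (hH.eigenvalues i * (P *ᵥ x) i) + d * (P *ᵥ y) i := by
    simpa [Matrix.mulVec_add, Matrix.mulVec_smul, hPK] using congrFun (congrArg (P *ᵥ ·) hy) i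
  by_contra! hne
  have hinj := Matrix.mulVec_injective_of_isUnit hP
  have hx0 : x = 0 := hinj <| by
    ext i
    refine (mul_eq_zero.mp ?_).resolve_left (hne i) |>.trans (by simp)
    linear_combination (z - d) * hpx i + b * hpy i
  have hy0 : y = 0 := hinj <| by
    ext i
    refine (mul_eq_zero.mp ?_).resolve_left (hne i) |>.trans (by simp)
    linear_combination (z - a * hH.eigenvalues i) * hpy i + c * hH.eigenvalues i * hpx i
  exact hv0 (by rw [hx0, hy0]; exact Sum.elim_zero_zero)

/-- For `0 < μ ≤ L`, `H` real symmetric positive definite with eigenvalues in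
`[μ, L]`, `η = √(μL)`, `τ = L/η`, and `α ∈ [0,1]`, every complex eigenvalue (root of the
characteristic polynomial over ℂ) of the AGM ODE matrix
`A = [[−(α/(ητ))H, −(1/η)I + (α/(ητ))I], [(1/τ)H, −(1/τ)I]]` has real part at most
`−(1/2)√(μ/L)`. -/
theorem agm_ode_matrix_eigenvalue_bound {n : ℕ} (μ L η τ α : ℝ)
    (hμ : 0 < μ) (hμL : μ ≤ L) (hη : η = Real.sqrt (μ * L)) (hτ : τ = L / η)
    (hα : α ∈ Set.Icc (0 : ℝ) 1)
    (H : Matrix (Fin n) (Fin n) ℝ) (hH : H.PosDef)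
    (heig : ∀ i, hH.isHermitian.eigenvalues i ∈ Set.Icc μ L) :
    ∀ z : ℂ,
      ((Matrix.fromBlocks ((-(α/(η*τ))) • H)
          ((-(1/η)) • (1 : Matrix (Fin n) (Fin n) ℝ) + (α/(η*τ)) • 1)
          ((1/τ) • H) ((-(1/τ)) • (1 : Matrix (Fin n) (Fin n) ℝ))).map
        (fun a => (a : ℂ))).charpoly.IsRoot z →
      z.re ≤ -((1/2) * Real.sqrt (μ / L)) := by
  intro z hz
  have hL : 0 < L := hμ.trans_le hμL
  have hη0 : 0 < η := hη ▸ Real.sqrt_pos.mpr (mul_pos hμ hL)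
  have hη2 : η ^ 2 = μ * L := hη ▸ Real.sq_sqrt (mul_pos hμ hL).le
  have hητ : η * τ = L := by rw [hτ]; field_simp
  have hs : Real.sqrt (μ / L) = η / L := by
    rw [Real.sqrt_eq_iff_mul_self_eq_of_pos (by positivity)]
    field_simp
    rw [hη2, mul_comm]
  have hτs : 1 / τ = η / L := by rw [hτ, one_div_div]
  rw [← add_smul] at hz
  obtain ⟨i, hi⟩ :=
    hH.isHermitian.exists_eigenvalue_of_isRoot_charpoly_fromBlocks _ _ _ _ hz
  rw [hητ, hτs] at hi
  obtain ⟨hle, -⟩ := heig i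
  set h := hH.isHermitian.eigenvalues i
  have hηL : η ≤ L := by
    refine (sq_le_sq₀ hη0.le hL.le).mp ?_
    nlinarith
  have hLc : (L : ℂ) ≠ 0 := by exact_mod_cast hL.ne'
  have hηc : (η : ℂ) ≠ 0 := by exact_mod_cast hη0.ne'
  have key := Complex.re_le_of_quadratic_root (s := η / L) (k := h / L) (α := α) (z := z)
    (by positivity)
    (by rw [div_pow, hη2, div_le_div_iff₀ (by positivity) hL]; nlinarith [mul_pos hL hL])
    ((div_le_one hL).mpr hηL) hα.1 hα.2
    (by
      rw [← hi]
      push_cast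
      field_simp
      ring)
  rw [hs]
  linarith
end

section
/- Let 0 < μ ≤ L, let H be a real symmetric positive definite n×n matrix all of whose eigenvalues are at least μ, and set β = (√L − √μ)/(√L + √μ) and γ = 4/(√L + √μ)². Define the 2n×2n real matrix A in block form as A = [[0, I], [−γH, −(1 − β)I]]. Then every complex eigenvalue of A has real part equal to −(1 − β)/2 = −√μ/(√L + √μ); in particular every eigenvalue has real part at most −√μ/(√L + √μ). -/
open Matrix in
/-- If `z` is a root of the characteristic polynomial of the companion-type block matrix
`[[0, I], [B, dI]]`, then `z² - dz` is a root of the characteristic polynomial of `B`. -/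
theorem Matrix.isRoot_charpoly_of_isRoot_charpoly_fromBlocks_zero_one {ι K : Type*} [Fintype ι]
    [DecidableEq ι] [Field K] (B : Matrix ι ι K) (d z : K)
    (hz : (fromBlocks 0 1 B (d • (1 : Matrix ι ι K))).charpoly.IsRoot z) :
    B.charpoly.IsRoot (z ^ 2 - d * z) := by
  rw [Polynomial.IsRoot.def, eval_charpoly, ← exists_mulVec_eq_zero_iff] at hz ⊢
  obtain ⟨v, hv, h⟩ := hz
  obtain ⟨u, w, rfl⟩ : ∃ u w, v = Sum.elim u w := ⟨_, _, (Sum.elim_comp_inl_inr v).symm⟩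
  have h' : z • Sum.elim u w = Sum.elim w (B *ᵥ u + d • w) := by
    rw [sub_mulVec, sub_eq_zero, fromBlocks_mulVec] at h
    simpa [smul_mulVec, ← smul_one_eq_diagonal] using h
  have h₁ : z • u = w := funext fun i => congrFun h' (Sum.inl i)
  have h₂ : z • w = B *ᵥ u + d • w := funext fun i => congrFun h' (Sum.inr i)
  refine ⟨u, ?_, ?_⟩
  · rintro rfl
    apply hv
    rw [← h₁]
    simp
  · have hB : B *ᵥ u = z • w - d • w := by rw [h₂, add_sub_cancel_right]
    rw [sub_mulVec, hB, ← h₁, scalar_apply, ← smul_one_eq_diagonal, smul_mulVec, one_mulVec]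
    module

/-- A complex root of a real monic quadratic with negative discriminant has real part equal to
minus half of the linear coefficient. -/
theorem Complex.re_eq_neg_half_of_quadratic_eq_zero {b c : ℝ} {z : ℂ} (hdisc : b ^ 2 < 4 * c)
    (hz : z ^ 2 + b * z + c = 0) : z.re = -(b / 2) := by
  have hre := congrArg Complex.re hz
  have him := congrArg Complex.im hz
  simp [pow_two] at hre him
  have hmul : z.im * (2 * z.re + b) = 0 := by linarith
  rcases mul_eq_zero.mp hmul with h | h
  · rw [h] at hre
    nlinarith [sq_nonneg (2 * z.re + b)]
  · linarith

/-- Every complex root of the characteristic polynomial of a real symmetric matrix is one of its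
(real) eigenvalues. -/
theorem Matrix.IsHermitian.exists_eigenvalues_eq_of_isRoot_charpoly_map {ι : Type*} [Fintype ι]
    [DecidableEq ι] {H : Matrix ι ι ℝ} (hH : H.IsHermitian) {z : ℂ}
    (hz : (H.map Complex.ofRealHom).charpoly.IsRoot z) : ∃ i, (hH.eigenvalues i : ℂ) = z := by
  rw [Matrix.charpoly_map, hH.charpoly_eq, Polynomial.IsRoot.def, Polynomial.map_prod,
    Polynomial.eval_prod, Finset.prod_eq_zero_iff] at hz
  obtain ⟨i, -, hi⟩ := hz
  refine ⟨i, ?_⟩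
  simp [sub_eq_zero] at hi
  exact hi.symm

/-- For `0 < μ ≤ L`, `H` real symmetric positive definite with all eigenvalues
at least `μ`, `β = (√L − √μ)/(√L + √μ)` and `γ = 4/(√L + √μ)²`, every complex eigenvalue
(root of the characteristic polynomial over ℂ) of the heavy-ball ODE matrix
`A = [[0, I], [−γH, −(1−β)I]]` has real part equal to `−(1−β)/2 = −√μ/(√L + √μ)`;
in particular every eigenvalue has real part at most `−√μ/(√L + √μ)`. -/
theorem heavyball_ode_matrix_eigenvalue_bound {n : ℕ} (μ L β γ : ℝ)
    (hμ : 0 < μ) (hμL : μ ≤ L)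
    (hβ : β = (Real.sqrt L - Real.sqrt μ) / (Real.sqrt L + Real.sqrt μ))
    (hγ : γ = 4 / (Real.sqrt L + Real.sqrt μ)^2)
    (H : Matrix (Fin n) (Fin n) ℝ) (hH : H.PosDef)
    (heig : ∀ i, μ ≤ hH.isHermitian.eigenvalues i) :
    ∀ z : ℂ,
      ((Matrix.fromBlocks (0 : Matrix (Fin n) (Fin n) ℝ) (1 : Matrix (Fin n) (Fin n) ℝ)
          ((-γ) • H) ((-(1-β)) • (1 : Matrix (Fin n) (Fin n) ℝ))).map
        (fun a => (a : ℂ))).charpoly.IsRoot z →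
      z.re = -((1-β)/2) ∧ -((1-β)/2) = -(Real.sqrt μ / (Real.sqrt L + Real.sqrt μ)) ∧
        z.re ≤ -(Real.sqrt μ / (Real.sqrt L + Real.sqrt μ)) := by
  intro z hz
  have hsμ : 0 < √μ := Real.sqrt_pos.mpr hμ
  have hs : 0 < √L + √μ := by positivity
  have hβ' : 1 - β = 2 * √μ / (√L + √μ) := by
    rw [hβ]
    field_simp
    ring
  have hγ_pos : 0 < γ := by
    rw [hγ]
    positivity
  have hhalf : -((1 - β) / 2) = -(√μ / (√L + √μ)) := by
    rw [hβ']
    ring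
  suffices hre : z.re = -((1 - β) / 2) from ⟨hre, hhalf, (hre.trans hhalf).le⟩
  have hblocks : (Matrix.fromBlocks (0 : Matrix (Fin n) (Fin n) ℝ) 1 ((-γ) • H)
      ((-(1 - β)) • (1 : Matrix (Fin n) (Fin n) ℝ))).map (fun a => (a : ℂ)) =
      Matrix.fromBlocks 0 1 (((-γ) • H).map Complex.ofRealHom)
        (((-(1 - β) : ℝ) : ℂ) • (1 : Matrix (Fin n) (Fin n) ℂ)) := by
    rw [Matrix.fromBlocks_map]
    congr 1 <;> ext i j <;> by_cases hij : i = j <;> simp [Matrix.one_apply, hij]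
  rw [hblocks] at hz
  have hroot := Matrix.isRoot_charpoly_of_isRoot_charpoly_fromBlocks_zero_one _ _ _ hz
  have hγH : (H.map Complex.ofRealHom).charpoly.IsRoot
      ((-(γ : ℂ))⁻¹ * (z ^ 2 - ((-(1 - β) : ℝ) : ℂ) * z)) := by
    have hγ_ne : -(γ : ℂ) ≠ 0 := neg_ne_zero.mpr (by exact_mod_cast hγ_pos.ne')
    rw [Polynomial.IsRoot.def, Matrix.eval_charpoly, ← Matrix.exists_mulVec_eq_zero_iff]
      at hroot ⊢
    obtain ⟨v, hv, h⟩ := hroot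
    refine ⟨v, hv, ?_⟩
    have hmap : ((-γ) • H).map Complex.ofRealHom = (-(γ : ℂ)) • H.map Complex.ofRealHom := by
      ext i j
      simp
    rw [hmap, Matrix.sub_mulVec, sub_eq_zero, Matrix.scalar_apply, ← Matrix.smul_one_eq_diagonal,
      Matrix.smul_mulVec, Matrix.one_mulVec, Matrix.smul_mulVec] at h
    rw [Matrix.sub_mulVec, sub_eq_zero, Matrix.scalar_apply, ← Matrix.smul_one_eq_diagonal,
      Matrix.smul_mulVec, Matrix.one_mulVec, mul_smul, h, inv_smul_smul₀ hγ_ne]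
  obtain ⟨i, hi⟩ := hH.isHermitian.exists_eigenvalues_eq_of_isRoot_charpoly_map hγH
  refine Complex.re_eq_neg_half_of_quadratic_eq_zero
    (c := γ * hH.isHermitian.eigenvalues i) ?_ ?_
  · have hsq : (1 - β) ^ 2 = γ * μ := by
      rw [hβ', hγ, div_pow, mul_pow, Real.sq_sqrt hμ.le]
      ring
    have hle := mul_le_mul_of_nonneg_left (heig i) hγ_pos.le
    have hpos := mul_pos hγ_pos hμ
    linarith
  · have hγ_ne : (γ : ℂ) ≠ 0 := by exact_mod_cast hγ_pos.ne'
    push_cast at hi ⊢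
    rw [hi]
    field_simp
    ring
end

section
/- Let 0 < μ ≤ L, set η = √(μL), and let λ be a real number with μ ≤ λ ≤ L. Then every complex root z of the quadratic polynomial z² + (1 + η/λ)z + 1 satisfies Re[z] ≤ −√μ/(√μ + √L). -/
/-- For `0 < μ ≤ L`, `η = √(μL)`, and `μ ≤ λ ≤ L`, every complex root `z` of
the quadratic `z² + (1 + η/λ)z + 1` satisfies `Re z ≤ −√μ/(√μ + √L)`. -/
theorem prox_block_root_bound (μ L η lam : ℝ)
    (hμ : 0 < μ) (hμL : μ ≤ L) (hη : η = Real.sqrt (μ * L))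
    (hlam : μ ≤ lam) (hlamL : lam ≤ L) :
    ∀ z : ℂ, z ^ 2 + (↑(1 + η / lam) : ℂ) * z + 1 = 0 →
      z.re ≤ -(Real.sqrt μ / (Real.sqrt μ + Real.sqrt L)) := by
  intro z hz
  have ha : 0 < √μ := Real.sqrt_pos.2 hμ
  have hab : √μ ≤ √L := Real.sqrt_le_sqrt hμL
  have hb : 0 < √L := ha.trans_le hab
  have hlam0 : 0 < lam := hμ.trans_le hlam
  rw [Real.sqrt_mul hμ.le] at hη
  have hr0 : 0 < η / lam := by rw [hη]; positivity
  have hr : √μ * (1 + η / lam) ≤ √μ + √L := by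
    have h : √μ * (η / lam) ≤ √L := by
      rw [← mul_div_assoc, div_le_iff₀ hlam0, hη, ← mul_assoc, Real.mul_self_sqrt hμ.le, mul_comm]
      gcongr
    linarith
  have hc1 : 1 ≤ 1 + η / lam := by linarith
  generalize 1 + η / lam = c at hz hr hc1
  have hre := congrArg Complex.re hz
  have him := congrArg Complex.im hz
  simp only [pow_two, Complex.add_re, Complex.mul_re, Complex.add_im, Complex.mul_im,
    Complex.ofReal_re, Complex.ofReal_im, Complex.one_re, Complex.one_im, Complex.zero_re,
    Complex.zero_im] at hre him
  rw [le_neg, div_le_iff₀ (by positivity)]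
  have hfac : z.im * (2 * z.re + c) = 0 := by linarith
  rcases mul_eq_zero.1 hfac with hy | hx
  · -- A real root satisfies `1 ≤ c * (-z.re)`, and `√μ * c ≤ √μ + √L`.
    have hcx : 1 ≤ c * -z.re := by
      rw [hy] at hre
      nlinarith [sq_nonneg z.re]
    have hx : 0 ≤ -z.re := by
      by_contra! h
      nlinarith
    calc √μ ≤ √μ * (c * -z.re) := le_mul_of_one_le_right ha.le hcx
      _ = -z.re * (√μ * c) := by ring
      _ ≤ -z.re * (√μ + √L) := by gcongr
  · -- A nonreal root has `z.re = -c / 2 ≤ -1 / 2`.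
    nlinarith
end

section
/- Let H be a real symmetric positive definite n×n matrix and let η > 0. Define the 2n×2n real matrix A = [[−I, −(1/η)I + H⁻¹], [ηI, −ηH⁻¹]]. Then the set of complex eigenvalues of A equals the set { z ∈ ℂ : there exists an eigenvalue λ of H with z² + (1 + η/λ)z + 1 = 0 }. -/
open Matrix Polynomial

/-- A block matrix over a field whose bottom left block is a nonzero scalar `c` is singular if and
only if `P * S - c • Q` is. -/
theorem Matrix.det_fromBlocks_smul_one₂₁_eq_zero_iff {m K : Type*} [Fintype m] [DecidableEq m]
    [Field K] (P Q S : Matrix m m K) {c : K} (hc : c ≠ 0) :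
    (fromBlocks P Q (c • 1) S).det = 0 ↔ (P * S - c • Q).det = 0 := by
  have hinv : fromBlocks S 1 (-c • 1) 0 * fromBlocks 0 (-c⁻¹ • 1) 1 (c⁻¹ • S) =
      (1 : Matrix (m ⊕ m) (m ⊕ m) K) := by
    simp [fromBlocks_multiply, smul_smul, hc]
  have hdet : (fromBlocks S 1 (-c • 1) (0 : Matrix m m K)).det ≠ 0 :=
    (isUnit_det_of_right_inverse hinv).ne_zero
  have hmul : fromBlocks P Q (c • 1) S * fromBlocks S 1 (-c • 1) 0 =
      fromBlocks (P * S - c • Q) P 0 (c • 1) := by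
    simp [fromBlocks_multiply, sub_eq_add_neg]
  have h := congrArg Matrix.det hmul
  rw [det_mul, det_fromBlocks_zero₂₁, det_smul, det_one, mul_one] at h
  rw [← mul_eq_zero_iff_right hdet, h, mul_eq_zero_iff_right (pow_ne_zero _ hc)]

/-- The determinant of an affine function of a Hermitian matrix in terms of its eigenvalues. -/
theorem Matrix.IsHermitian.det_smul_add_smul_one {m 𝕜 : Type*} [Fintype m] [DecidableEq m]
    [RCLike 𝕜] {M : Matrix m m 𝕜} (hM : M.IsHermitian) (a b : 𝕜) :
    (a • M + b • 1).det = ∏ i, (a * hM.eigenvalues i + b) := by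
  have h : a • M + b • 1 = Unitary.conjStarAlgAut 𝕜 _ hM.eigenvectorUnitary
      (diagonal fun i => a * (hM.eigenvalues i : 𝕜) + b) := by
    have hdiag : (diagonal fun i => a * (hM.eigenvalues i : 𝕜) + b) =
        a • diagonal (RCLike.ofReal ∘ hM.eigenvalues) + b • 1 := by
      ext i j
      by_cases hij : i = j <;> simp [hij]
    rw [hdiag, map_add, map_smul, map_smul, map_one, ← hM.spectral_theorem]
  rw [h, Unitary.conjStarAlgAut_apply, det_mul_right_comm, Unitary.mul_star_self_of_mem
    hM.eigenvectorUnitary.2, one_mul, det_diagonal]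

/-- For `H` real symmetric positive definite and `η > 0`, the set of complex
eigenvalues (roots of the characteristic polynomial over ℂ) of the block matrix
`A = [[−I, −(1/η)I + H⁻¹], [ηI, −ηH⁻¹]]` equals the set of `z ∈ ℂ` such that there exists
an eigenvalue `λ` of `H` (a root of `H`'s characteristic polynomial) with
`z² + (1 + η/λ)z + 1 = 0`. -/
theorem prox_ode_matrix_spectrum_eq {n : ℕ} (η : ℝ) (hη : 0 < η)
    (H : Matrix (Fin n) (Fin n) ℝ) (hH : H.PosDef) :
    {z : ℂ |
      ((Matrix.fromBlocks (-1 : Matrix (Fin n) (Fin n) ℝ) ((-(1/η)) • 1 + H⁻¹)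
          (η • (1 : Matrix (Fin n) (Fin n) ℝ)) ((-η) • H⁻¹)).map
        (fun a => (a : ℂ))).charpoly.IsRoot z} =
    {z : ℂ | ∃ lam : ℝ, H.charpoly.IsRoot lam ∧
      z ^ 2 + (↑(1 + η / lam) : ℂ) * z + 1 = 0} := by
  ext z
  simp only [Set.mem_ofPred_eq]
  set F : Matrix (Fin n) (Fin n) ℂ := H.map Complex.ofRealHom with hF
  set K : Matrix (Fin n) (Fin n) ℂ := H⁻¹.map Complex.ofRealHom with hK
  have hη0 : (η : ℂ) ≠ 0 := Complex.ofReal_ne_zero.mpr hη.ne'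
  have hdetH : H.det ≠ 0 := hH.det_pos.ne'
  have hKF : K * F = 1 := by
    rw [hF, hK, ← Matrix.map_mul, nonsing_inv_mul _ hdetH.isUnit]
    simp
  have hdetF : F.det ≠ 0 := (isUnit_det_of_left_inverse hKF).ne_zero
  have hFherm : F.IsHermitian := by
    refine hH.isHermitian.map _ fun x => ?_
    simp
  have hroot (lam : ℝ) : H.charpoly.IsRoot lam ↔ ∃ i, hFherm.eigenvalues i = lam := by
    rw [← isRoot_map_iff (f := Complex.ofRealHom) Complex.ofReal_injective, ← charpoly_map,
      hFherm.charpoly_eq, IsRoot.def, eval_prod, Finset.prod_eq_zero_iff]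
    simp [sub_eq_zero, eq_comm (a := lam)]
  have hne (i : Fin n) : (hFherm.eigenvalues i : ℂ) ≠ 0 := by
    have h := hFherm.det_eq_prod_eigenvalues ▸ hdetF
    exact Finset.prod_ne_zero_iff.mp h i (Finset.mem_univ i)
  have hblocks : scalar (Fin n ⊕ Fin n) z - (fromBlocks (-1 : Matrix (Fin n) (Fin n) ℝ)
      ((-(1/η)) • 1 + H⁻¹) (η • (1 : Matrix (Fin n) (Fin n) ℝ)) ((-η) • H⁻¹)).map
        (fun a => (a : ℂ)) =
      fromBlocks ((z + 1) • 1) ((η : ℂ)⁻¹ • 1 - K) (-(η : ℂ) • 1) (z • 1 + (η : ℂ) • K) := by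
    ext (i | i) (j | j) <;> by_cases hij : i = j <;> simp [hij, hK, one_apply] <;> ring
  have hschur : (((z + 1) • (1 : Matrix (Fin n) (Fin n) ℂ)) * (z • 1 + (η : ℂ) • K) -
      -(η : ℂ) • ((η : ℂ)⁻¹ • 1 - K)) * F = (z ^ 2 + z + 1) • F + (z * η) • 1 := by
    have h : ((z + 1) • (1 : Matrix (Fin n) (Fin n) ℂ)) * (z • 1 + (η : ℂ) • K) -
        -(η : ℂ) • ((η : ℂ)⁻¹ • 1 - K) = (z ^ 2 + z + 1) • 1 + (z * η) • K := by
      rw [smul_mul_assoc, one_mul, smul_sub, smul_smul, neg_mul, mul_inv_cancel₀ hη0]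
      module
    rw [h, add_mul, smul_mul_assoc, smul_mul_assoc, hKF, one_mul]
  rw [IsRoot.def, eval_charpoly, hblocks,
    det_fromBlocks_smul_one₂₁_eq_zero_iff _ _ _ (neg_ne_zero.mpr hη0),
    ← mul_eq_zero_iff_right hdetF, ← det_mul, hschur, hFherm.det_smul_add_smul_one,
    Finset.prod_eq_zero_iff]
  simp only [hroot, Finset.mem_univ, true_and, exists_exists_eq_and]
  refine exists_congr fun i => ?_
  change (z ^ 2 + z + 1) * (hFherm.eigenvalues i : ℂ) + z * η = 0 ↔ _
  rw [← mul_eq_zero_iff_right (hne i) (a := _ + _ + 1)]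
  have hi := hne i
  push_cast
  refine Eq.congr_left ?_
  field_simp
  ring
end

section
/- Let E be a real inner product space, f : E → ℝ differentiable with gradient ∇f, and let 0 < μ ≤ L with α = √(μ/L), γ = μ, and β = (√L − √μ)/(√L + √μ). Suppose sequences x, v, y : ℕ → E satisfy, for all k: y^k = (αγ v^k + γ x^k)/(αμ + γ), x^{k+1} = y^k − (1/L)∇f(y^k), and v^{k+1} = (1 − α)v^k + (αμ/γ)y^k − (α/γ)∇f(y^k). Then for all k ≥ 1, y^k = x^k + β(x^k − x^{k−1}); that is, the iterates also satisfy Nesterov's form II: x^{k+1} = y^k − (1/L)∇f(y^k), y^{k+1} = x^{k+1} + β(x^{k+1} − x^k). -/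
/-- In a real inner product space, if `g` is the gradient of `f` (expressed
via the Fréchet derivative paired with the inner product), `α = √(μ/L)`, `γ = μ`,
`β = (√L − √μ)/(√L + √μ)`, and the sequences `x, v, y` satisfy Nesterov's form I:
`y^k = (αγ v^k + γ x^k)/(αμ + γ)`, `x^{k+1} = y^k − (1/L)∇f(y^k)`,
`v^{k+1} = (1 − α)v^k + (αμ/γ)y^k − (α/γ)∇f(y^k)`, then for all `k ≥ 1`,
`y^k = x^k + β(x^k − x^{k−1})`, i.e. the iterates satisfy Nesterov's form II. -/
theorem nesterov_formI_to_formII {E : Type*} [NormedAddCommGroup E] [InnerProductSpace ℝ E]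
    (f : E → ℝ) (g : E → E)
    (hg : ∀ w, HasFDerivAt f (InnerProductSpace.toDualMap ℝ E (g w)) w)
    (μ L α γ β : ℝ) (hμ : 0 < μ) (hμL : μ ≤ L)
    (hα : α = Real.sqrt (μ / L)) (hγ : γ = μ)
    (hβ : β = (Real.sqrt L - Real.sqrt μ) / (Real.sqrt L + Real.sqrt μ))
    (x v y : ℕ → E)
    (hy : ∀ k, y k = ((α * μ + γ)⁻¹) • ((α * γ) • v k + γ • x k))
    (hx : ∀ k, x (k+1) = y k - (1/L) • g (y k))
    (hv : ∀ k, v (k+1) = (1 - α) • v k + (α * μ / γ) • y k - (α / γ) • g (y k)) :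
    ∀ k, y (k+1) = x (k+1) + β • (x (k+1) - x k) := by
  intro k
  have hL : 0 < L := hμ.trans_le hμL
  have hα0 : 0 < α := hα ▸ Real.sqrt_pos.2 (div_pos hμ hL)
  have hμα : μ = α ^ 2 * L := by
    rw [hα, Real.sq_sqrt (div_pos hμ hL).le, div_mul_cancel₀ _ hL.ne']
  have hβα : β = (1 - α) / (1 + α) := by
    have hsL : 0 < Real.sqrt L := Real.sqrt_pos.2 hL
    rw [hβ, hα, Real.sqrt_div hμ.le]
    field_simp
  have hα1 : 1 + α ≠ 0 := by positivity
  have hvk : v k = α⁻¹ • ((1 + α) • y k - x k) := by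
    rw [hy k, hγ, hμα]
    match_scalars <;> field_simp <;> ring
  rw [hy (k + 1), hv k, hvk, hx k, hβα, hγ, hμα]
  match_scalars <;> field_simp <;> ring
end
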